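/- Let m ≥ 0, b > 0 and s ∈ {−1, +1}, and for z ∈ ℝ³ \ {0} define G(z) := −(1/√π) ∫₀^∞ τ^{−1/2} · (d/dτ)[ e^{−τm²} e^{sbτ} N_b(τ,z) ] dτ. Then the leading singularity of G at the origin is −1/(π²|z|⁴): there exist constants C > 0 and δ > 0 such that for all z with 0 < |z| < δ one has | G(z) + 1/(π² |z|⁴) | ≤ C / |z|². -/

import Mathlib

open Real MeasureTheory

/-- The hyperbolic cotangent `coth z = cosh z / sinh z`. -/
noncomputable def coth (z : ℝ) : ℝ := Real.cosh z / Real.sinh z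

/-- The phase-free Mehler heat kernel `N_b(τ,z)` for a constant magnetic field of
strength `b`. -/
noncomputable def mehlerN (b τ : ℝ) (z : EuclideanSpace ℝ (Fin 3)) : ℝ :=
  (4 * π * τ) ^ (-(1 : ℝ) / 2) * (b / (4 * π * Real.sinh (b * τ))) *
    Real.exp (-(z 2) ^ 2 / (4 * τ)) *
    Real.exp (-(b / 4) * coth (b * τ) * ((z 0) ^ 2 + (z 1) ^ 2))

/-- The kernel `G(z) = -(1/√π) ∫₀^∞ τ^{-1/2} (d/dτ)[e^{-τm²} e^{sbτ} N_b(τ,z)] dτ` of the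
pseudorelativistic kinetic energy operator `E_A = |α(p - eA) + βm|` (up to a phase). -/
noncomputable def kinKernel (m b s : ℝ) (z : EuclideanSpace ℝ (Fin 3)) : ℝ :=
  -(1 / Real.sqrt π) * ∫ τ in Set.Ioi (0 : ℝ),
    τ ^ (-(1 : ℝ) / 2) *
      deriv (fun σ : ℝ => Real.exp (-σ * m ^ 2) * Real.exp (s * b * σ) * mehlerN b σ z) τ


lemma aux_sinh_le (x : ℝ) (hx : 0 ≤ x) : Real.sinh x ≤ x * Real.cosh x := by
  have hmono : MonotoneOn (fun y : ℝ => y * Real.cosh y - Real.sinh y) (Set.Ici 0) := by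
    apply monotoneOn_of_deriv_nonneg (convex_Ici 0)
    · fun_prop
    · fun_prop
    · intro y hy
      rw [interior_Ici] at hy
      have h : HasDerivAt (fun y : ℝ => y * Real.cosh y - Real.sinh y)
          ((1 * Real.cosh y + y * Real.sinh y) - Real.cosh y) y :=
        ((hasDerivAt_id y).mul (Real.hasDerivAt_cosh y)).sub (Real.hasDerivAt_sinh y)
      rw [h.deriv]
      have := mul_nonneg (le_of_lt hy) (Real.sinh_nonneg_iff.2 (le_of_lt hy))
      linarith
  have := hmono (Set.mem_Ici.2 le_rfl) (Set.mem_Ici.2 hx) hx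
  simp at this
  linarith

lemma aux_cosh_le (x : ℝ) (hx : 0 ≤ x) : x * Real.cosh x ≤ (1 + x ^ 2) * Real.sinh x := by
  have hmono : MonotoneOn (fun y : ℝ => (1 + y ^ 2) * Real.sinh y - y * Real.cosh y)
      (Set.Ici 0) := by
    apply monotoneOn_of_deriv_nonneg (convex_Ici 0)
    · fun_prop
    · fun_prop
    · intro y hy
      rw [interior_Ici] at hy
      have h : HasDerivAt (fun y : ℝ => (1 + y ^ 2) * Real.sinh y - y * Real.cosh y)
          (((2 * y) * Real.sinh y + (1 + y ^ 2) * Real.cosh y)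
            - (1 * Real.cosh y + y * Real.sinh y)) y := by
        refine HasDerivAt.sub (HasDerivAt.mul ?_ (Real.hasDerivAt_sinh y))
          ((hasDerivAt_id y).mul (Real.hasDerivAt_cosh y))
        have := ((hasDerivAt_id y).pow 2).const_add 1
        simpa using this
      rw [h.deriv]
      have h1 := mul_nonneg (le_of_lt hy) (Real.sinh_nonneg_iff.2 (le_of_lt hy))
      have h2 := mul_nonneg (sq_nonneg y) (Real.cosh_pos y).le
      linarith
  have := hmono (Set.mem_Ici.2 le_rfl) (Set.mem_Ici.2 hx) hx
  simp at this
  linarith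

/-- `coth x ≤ 1 + 1/x` -/
lemma aux_cosh_le' (x : ℝ) : x * Real.cosh x ≤ (x + 1) * Real.sinh x := by
  have h1 : x * (Real.cosh x - Real.sinh x) ≤ Real.sinh x := by
    rw [Real.cosh_sub_sinh, Real.sinh_eq]
    have h2 : Real.exp x = Real.exp (2 * x) * Real.exp (-x) := by
      rw [← Real.exp_add]; ring_nf
    have h3 := Real.add_one_le_exp (2 * x)
    have h4 := Real.exp_pos (-x)
    rw [h2]
    nlinarith
  linarith

lemma coth_lower {x : ℝ} (hx : 0 < x) : 1 / x ≤ coth x := by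
  have hs := Real.sinh_pos_iff.2 hx
  rw [coth, div_le_div_iff₀ hx hs]
  have := aux_sinh_le x hx.le
  linarith

lemma coth_upper {x : ℝ} (hx : 0 < x) : coth x ≤ 1 + 1 / x := by
  have hs := Real.sinh_pos_iff.2 hx
  have := aux_cosh_le' x
  rw [coth, div_le_iff₀ hs]
  have e : (1 + 1 / x) * Real.sinh x = ((x + 1) * Real.sinh x) / x := by field_simp
  rw [e, le_div_iff₀ hx]; linarith

lemma coth_upper2 {x : ℝ} (hx : 0 < x) : coth x ≤ 1 / x + x := by
  have hs := Real.sinh_pos_iff.2 hx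
  have := aux_cosh_le x hx.le
  rw [coth, div_le_iff₀ hs]
  have e : (1 / x + x) * Real.sinh x = ((1 + x ^ 2) * Real.sinh x) / x := by field_simp
  rw [e, le_div_iff₀ hx]; linarith

/-- `exp x * x / sinh x = x (coth x + 1)` -/
lemma exp_mul_div_sinh {x : ℝ} (hx : 0 < x) :
    Real.exp x * (x / Real.sinh x) ≤ 1 + 2 * x := by
  have hs := Real.sinh_pos_iff.2 hx
  have h := aux_cosh_le' x
  have e : Real.exp x = Real.cosh x + Real.sinh x := (Real.cosh_add_sinh x).symm
  rw [← mul_div_assoc, div_le_iff₀ hs, e]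
  linarith

lemma exp_neg_le_div_sinh {x : ℝ} (hx : 0 < x) :
    Real.exp (-x) ≤ x / Real.sinh x := by
  have hs := Real.sinh_pos_iff.2 hx
  rw [le_div_iff₀ hs]
  have h1 : Real.sinh x ≤ x * Real.exp x := by
    have := aux_sinh_le x hx.le
    have e : Real.exp x = Real.cosh x + Real.sinh x := (Real.cosh_add_sinh x).symm
    rw [e]; nlinarith
  have h2 : Real.exp (-x) * Real.exp x = 1 := by rw [← Real.exp_add]; simp
  have h3 := Real.exp_pos (-x)
  nlinarith

lemma int_inv_sq {a : ℝ} (ha : 0 < a) :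
    IntegrableOn (fun t : ℝ => 1 / t ^ 2 * Real.exp (-(a / t))) (Set.Ioi 0) ∧
    ∫ t in Set.Ioi (0 : ℝ), 1 / t ^ 2 * Real.exp (-(a / t)) = 1 / a := by
  have key : ∀ t ∈ Set.Ioi (0 : ℝ), (|(-1 : ℝ)| * t ^ ((-1 : ℝ) - 1)) •
      (fun y : ℝ => Real.exp (-a * y)) (t ^ (-1 : ℝ)) = 1 / t ^ 2 * Real.exp (-(a / t)) := by
    intro t ht
    have ht : (0 : ℝ) < t := ht
    have e2 : t ^ ((-1 : ℝ) - 1) = 1 / t ^ 2 := by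
      rw [show ((-1 : ℝ) - 1) = -((2 : ℕ) : ℝ) by norm_num, Real.rpow_neg ht.le,
        Real.rpow_natCast, one_div]
    simp only [smul_eq_mul, Real.rpow_neg_one, e2]
    rw [abs_neg, abs_one, one_mul, div_eq_mul_inv a, neg_mul]
  have hI : IntegrableOn (fun y : ℝ => Real.exp (-a * y)) (Set.Ioi 0) :=
    exp_neg_integrableOn_Ioi 0 ha
  constructor
  · have := (integrableOn_Ioi_comp_rpow_iff (fun y : ℝ => Real.exp (-a * y))
      (p := -1) (by norm_num)).2 hI
    exact this.congr_fun key measurableSet_Ioi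
  · rw [← setIntegral_congr_fun measurableSet_Ioi key,
      integral_comp_rpow_Ioi (fun y : ℝ => Real.exp (-a * y)) (p := -1) (by norm_num)]
    rw [integral_exp_mul_Ioi (by linarith) 0]
    simp

lemma int_inv_cube {a : ℝ} (ha : 0 < a) :
    IntegrableOn (fun t : ℝ => 1 / t ^ 3 * Real.exp (-(a / t))) (Set.Ioi 0) ∧
    ∫ t in Set.Ioi (0 : ℝ), 1 / t ^ 3 * Real.exp (-(a / t)) = 1 / a ^ 2 := by
  have key : ∀ t ∈ Set.Ioi (0 : ℝ), (|(-1 : ℝ)| * t ^ ((-1 : ℝ) - 1)) •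
      (fun y : ℝ => y ^ ((2 : ℝ) - 1) * Real.exp (-(a * y))) (t ^ (-1 : ℝ))
        = 1 / t ^ 3 * Real.exp (-(a / t)) := by
    intro t ht
    have ht : (0 : ℝ) < t := ht
    have e2 : t ^ ((-1 : ℝ) - 1) = 1 / t ^ 2 := by
      rw [show ((-1 : ℝ) - 1) = -((2 : ℕ) : ℝ) by norm_num, Real.rpow_neg ht.le,
        Real.rpow_natCast, one_div]
    simp only [smul_eq_mul, Real.rpow_neg_one, e2]
    rw [abs_neg, abs_one, one_mul, div_eq_mul_inv a, show (2 : ℝ) - 1 = 1 by norm_num,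
      Real.rpow_one]
    field_simp
  have hv := Real.integral_rpow_mul_exp_neg_mul_Ioi (a := 2) (r := a) (by norm_num) ha
  have hg : Real.Gamma 2 = 1 := Real.Gamma_two
  rw [hg, mul_one] at hv
  have hv' : ∫ (t : ℝ) in Set.Ioi 0, t ^ ((2 : ℝ) - 1) * Real.exp (-(a * t)) = 1 / a ^ 2 := by
    rw [hv]
    rw [show (2 : ℝ) = ((2 : ℕ) : ℝ) by norm_num, Real.rpow_natCast]
    simp
  have hI : IntegrableOn (fun y : ℝ => y ^ ((2 : ℝ) - 1) * Real.exp (-(a * y))) (Set.Ioi 0) := by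
    by_contra hne
    rw [integral_undef hne] at hv'
    have : 0 < 1 / a ^ 2 := by positivity
    linarith
  constructor
  · have := (integrableOn_Ioi_comp_rpow_iff
      (fun y : ℝ => y ^ ((2 : ℝ) - 1) * Real.exp (-(a * y))) (p := -1) (by norm_num)).2 hI
    exact this.congr_fun key measurableSet_Ioi
  · rw [← setIntegral_congr_fun measurableSet_Ioi key,
      integral_comp_rpow_Ioi (fun y : ℝ => y ^ ((2 : ℝ) - 1) * Real.exp (-(a * y)))
        (p := -1) (by norm_num)]
    exact hv'

noncomputable def fK (m b s : ℝ) (z : EuclideanSpace ℝ (Fin 3)) (σ : ℝ) : ℝ :=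
  Real.exp (-σ * m ^ 2) * Real.exp (s * b * σ) * mehlerN b σ z

noncomputable def hK (m b s : ℝ) (z : EuclideanSpace ℝ (Fin 3)) (τ : ℝ) : ℝ :=
  Real.exp (-τ * m ^ 2) * Real.exp (s * b * τ) * (b * τ / Real.sinh (b * τ)) *
    Real.exp (-(((z 0) ^ 2 + (z 1) ^ 2) / 4 * (b * coth (b * τ) - 1 / τ)))

noncomputable def kap : ℝ := (4 * π) ^ (-(1 : ℝ) / 2) / (4 * π)

noncomputable def lK (m b s : ℝ) (z : EuclideanSpace ℝ (Fin 3)) (τ : ℝ) : ℝ :=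
  s * b - m ^ 2 - 1 / (2 * τ) - b * coth (b * τ) + (z 2) ^ 2 / (4 * τ ^ 2)
    + ((z 0) ^ 2 + (z 1) ^ 2) / 4 * (b ^ 2 / Real.sinh (b * τ) ^ 2)

lemma kap_pos : 0 < kap := by unfold kap; positivity

lemma rpow_half_sq {t : ℝ} (ht : 0 < t) : t ^ (-(1 : ℝ) / 2) * t ^ (-(1 : ℝ) / 2) = 1 / t := by
  rw [← Real.rpow_add ht]; norm_num [Real.rpow_neg_one]

lemma norm_sq3 (z : EuclideanSpace ℝ (Fin 3)) :
    ‖z‖ ^ 2 = (z 0) ^ 2 + (z 1) ^ 2 + (z 2) ^ 2 := by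
  rw [EuclideanSpace.norm_sq_eq, Fin.sum_univ_three]; simp

lemma rep (m b s : ℝ) (hb : 0 < b) (z : EuclideanSpace ℝ (Fin 3)) {τ : ℝ} (ht : 0 < τ) :
    τ ^ (-(1 : ℝ) / 2) * fK m b s z τ =
      kap * (1 / τ ^ 2 * Real.exp (-(‖z‖ ^ 2 / 4 / τ)) * hK m b s z τ) := by
  have hs : 0 < Real.sinh (b * τ) := Real.sinh_pos_iff.2 (by positivity)
  have e1 : (4 * π * τ) ^ (-(1 : ℝ) / 2) = (4 * π) ^ (-(1 : ℝ) / 2) * τ ^ (-(1 : ℝ) / 2) :=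
    Real.mul_rpow (by positivity) ht.le
  have e2 : Real.exp (-(z 2) ^ 2 / (4 * τ)) *
      Real.exp (-(b / 4) * coth (b * τ) * ((z 0) ^ 2 + (z 1) ^ 2)) =
      Real.exp (-(‖z‖ ^ 2 / 4 / τ)) *
      Real.exp (-(((z 0) ^ 2 + (z 1) ^ 2) / 4 * (b * coth (b * τ) - 1 / τ))) := by
    rw [← Real.exp_add, ← Real.exp_add, norm_sq3]
    congr 1
    field_simp
    ring
  have e3 := rpow_half_sq ht
  unfold fK hK mehlerN kap
  rw [e1]
  calc _ = (4 * π) ^ (-(1 : ℝ) / 2) * (τ ^ (-(1 : ℝ) / 2) * τ ^ (-(1 : ℝ) / 2)) *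
        (b / (4 * π * Real.sinh (b * τ))) * (Real.exp (-τ * m ^ 2) * Real.exp (s * b * τ)) *
        (Real.exp (-(z 2) ^ 2 / (4 * τ)) *
      Real.exp (-(b / 4) * coth (b * τ) * ((z 0) ^ 2 + (z 1) ^ 2))) := by ring
    _ = _ := by
      rw [e2, e3]
      field_simp

lemma hasDerivAt_coth {x : ℝ} (hx : 0 < x) : HasDerivAt coth (-(1 / Real.sinh x ^ 2)) x := by
  have hs : 0 < Real.sinh x := Real.sinh_pos_iff.2 hx
  have h := (Real.hasDerivAt_cosh x).div (Real.hasDerivAt_sinh x) hs.ne'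
  have e : (Real.sinh x * Real.sinh x - Real.cosh x * Real.cosh x) / Real.sinh x ^ 2
      = -(1 / Real.sinh x ^ 2) := by
    have := Real.cosh_sq x
    rw [show Real.sinh x * Real.sinh x - Real.cosh x * Real.cosh x = -1 by nlinarith]
    ring
  rw [e] at h
  exact h

lemma hasDerivAt_fK (m b s : ℝ) (hb : 0 < b) (z : EuclideanSpace ℝ (Fin 3)) {τ : ℝ}
    (ht : 0 < τ) : HasDerivAt (fK m b s z) (fK m b s z τ * lK m b s z τ) τ := by
  have hs : 0 < Real.sinh (b * τ) := Real.sinh_pos_iff.2 (by positivity)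
  have hbt : HasDerivAt (fun t : ℝ => b * t) b τ := by simpa using (hasDerivAt_id τ).const_mul b
  have d1 : HasDerivAt (fun t : ℝ => Real.exp (-t * m ^ 2))
      (Real.exp (-τ * m ^ 2) * (-m ^ 2)) τ := by
    have : HasDerivAt (fun t : ℝ => -t * m ^ 2) (-m ^ 2) τ := by
      simpa using (hasDerivAt_id τ).neg.mul_const (m ^ 2)
    exact this.exp
  have d2 : HasDerivAt (fun t : ℝ => Real.exp (s * b * t))
      (Real.exp (s * b * τ) * (s * b)) τ := by
    have : HasDerivAt (fun t : ℝ => s * b * t) (s * b) τ := by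
      simpa using (hasDerivAt_id τ).const_mul (s * b)
    exact this.exp
  have d3 : HasDerivAt (fun t : ℝ => (4 * π * t) ^ (-(1 : ℝ) / 2))
      ((4 * π * τ) ^ (-(1 : ℝ) / 2) * (-(1 / (2 * τ)))) τ := by
    have h0 : HasDerivAt (fun t : ℝ => 4 * π * t) (4 * π) τ := by
      simpa using (hasDerivAt_id τ).const_mul (4 * π)
    have hp : 0 < 4 * π * τ := by positivity
    have := h0.rpow_const (p := -(1 : ℝ) / 2) (Or.inl hp.ne')
    refine this.congr_deriv ?_
    rw [Real.rpow_sub_one hp.ne']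
    field_simp
  have d4 : HasDerivAt (fun t : ℝ => b / (4 * π * Real.sinh (b * t)))
      (b / (4 * π * Real.sinh (b * τ)) * (-(b * coth (b * τ)))) τ := by
    have h0 : HasDerivAt (fun t : ℝ => 4 * π * Real.sinh (b * t))
        (4 * π * (Real.cosh (b * τ) * b)) τ := (hbt.sinh).const_mul (4 * π)
    have := (hasDerivAt_const τ b).div h0 (by positivity)
    refine this.congr_deriv ?_
    unfold coth
    field_simp
    ring
  have d5 : HasDerivAt (fun t : ℝ => Real.exp (-(z 2) ^ 2 / (4 * t)))
      (Real.exp (-(z 2) ^ 2 / (4 * τ)) * ((z 2) ^ 2 / (4 * τ ^ 2))) τ := by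
    have h0 : HasDerivAt (fun t : ℝ => 4 * t) 4 τ := by simpa using (hasDerivAt_id τ).const_mul 4
    have := (hasDerivAt_const τ (-(z 2) ^ 2)).div h0 (by positivity)
    have h2 : HasDerivAt (fun t : ℝ => -(z 2) ^ 2 / (4 * t)) ((z 2) ^ 2 / (4 * τ ^ 2)) τ := by
      refine this.congr_deriv ?_
      field_simp
      ring
    exact h2.exp
  have d6 : HasDerivAt (fun t : ℝ =>
      Real.exp (-(b / 4) * coth (b * t) * ((z 0) ^ 2 + (z 1) ^ 2)))
      (Real.exp (-(b / 4) * coth (b * τ) * ((z 0) ^ 2 + (z 1) ^ 2)) *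
        (((z 0) ^ 2 + (z 1) ^ 2) / 4 * (b ^ 2 / Real.sinh (b * τ) ^ 2))) τ := by
    have h0 : HasDerivAt (fun t : ℝ => coth (b * t)) (-(1 / Real.sinh (b * τ) ^ 2) * b) τ :=
      (hasDerivAt_coth (x := b * τ) (by positivity)).comp τ hbt
    have h1 := (h0.const_mul (-(b / 4))).mul_const ((z 0) ^ 2 + (z 1) ^ 2)
    have h2 := h1.exp
    refine h2.congr_deriv ?_
    ring
  have d := (d1.mul d2).mul (((d3.mul d4).mul d5).mul d6)
  unfold fK mehlerN lK
  refine d.congr_deriv ?_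
  simp only [Pi.mul_apply]
  ring

lemma hK_nonneg (m b s : ℝ) (hb : 0 < b) (z : EuclideanSpace ℝ (Fin 3)) {τ : ℝ} (ht : 0 < τ) :
    0 ≤ hK m b s z τ := by
  have hs : 0 < Real.sinh (b * τ) := Real.sinh_pos_iff.2 (by positivity)
  unfold hK; positivity

lemma coth_b {b τ : ℝ} (hb : 0 < b) (ht : 0 < τ) : 0 ≤ b * coth (b * τ) - 1 / τ ∧
    b * coth (b * τ) - 1 / τ ≤ b ∧ b * coth (b * τ) - 1 / τ ≤ b ^ 2 * τ := by
  have hx : 0 < b * τ := by positivity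
  have e : b * (1 / (b * τ)) = 1 / τ := by field_simp
  have h1 := mul_le_mul_of_nonneg_left (coth_lower hx) hb.le
  have h2 := mul_le_mul_of_nonneg_left (coth_upper hx) hb.le
  have h3 := mul_le_mul_of_nonneg_left (coth_upper2 hx) hb.le
  rw [mul_add] at h2 h3
  rw [e] at h1 h2 h3
  refine ⟨by linarith, by linarith, by nlinarith⟩

lemma hK_le (m b s : ℝ) (hb : 0 < b) (z : EuclideanSpace ℝ (Fin 3)) {τ : ℝ} (ht : 0 < τ) :
    hK m b s z τ ≤ Real.exp (-((m ^ 2 + (1 - s) * b) * τ)) * (1 + 2 * b * τ) := by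
  have hx : 0 < b * τ := by positivity
  have hs : 0 < Real.sinh (b * τ) := Real.sinh_pos_iff.2 hx
  have h1 := exp_mul_div_sinh hx
  have h2 : Real.exp (-(((z 0) ^ 2 + (z 1) ^ 2) / 4 * (b * coth (b * τ) - 1 / τ))) ≤ 1 := by
    rw [Real.exp_le_one_iff, neg_nonpos]
    exact mul_nonneg (by positivity) (coth_b hb ht).1
  have e : Real.exp (-τ * m ^ 2) * Real.exp (s * b * τ) =
      Real.exp (-((m ^ 2 + (1 - s) * b) * τ)) * Real.exp (b * τ) := by
    rw [← Real.exp_add, ← Real.exp_add]; ring_nf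
  unfold hK
  rw [e]
  calc _ ≤ Real.exp (-((m ^ 2 + (1 - s) * b) * τ)) * Real.exp (b * τ) *
        (b * τ / Real.sinh (b * τ)) * 1 := by gcongr
    _ = Real.exp (-((m ^ 2 + (1 - s) * b) * τ)) * (Real.exp (b * τ) *
        (b * τ / Real.sinh (b * τ))) := by ring
    _ ≤ _ := by
      gcongr
      linarith

lemma hK_le' (m b s : ℝ) (hb : 0 < b) (hs : s ≤ 1) (z : EuclideanSpace ℝ (Fin 3)) {τ : ℝ}
    (ht : 0 < τ) : hK m b s z τ ≤ 1 + 2 * b * τ := by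
  have h := hK_le m b s hb z ht
  have h1 : Real.exp (-((m ^ 2 + (1 - s) * b) * τ)) ≤ 1 := by
    rw [Real.exp_le_one_iff, neg_nonpos]
    have : 0 ≤ (1 - s) * b := mul_nonneg (by linarith) hb.le
    positivity
  have h2 : 0 ≤ 1 + 2 * b * τ := by positivity
  nlinarith

lemma hK_ge (m b s : ℝ) (hb : 0 < b) (hs : -1 ≤ s) (z : EuclideanSpace ℝ (Fin 3))
    (hz : ‖z‖ ≤ 1) {τ : ℝ} (ht : 0 < τ) :
    1 - (2 * b + m ^ 2 + b ^ 2) * τ ≤ hK m b s z τ := by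
  have hx : 0 < b * τ := by positivity
  have h1 := exp_neg_le_div_sinh hx
  have h2 : Real.exp (-(b ^ 2 * τ)) ≤
      Real.exp (-(((z 0) ^ 2 + (z 1) ^ 2) / 4 * (b * coth (b * τ) - 1 / τ))) := by
    apply Real.exp_le_exp.2
    have hc := coth_b hb ht
    have hn := norm_sq3 z
    have : ‖z‖ ^ 2 ≤ 1 := pow_le_one₀ (norm_nonneg z) hz
    have h4 : ((z 0) ^ 2 + (z 1) ^ 2) / 4 ≤ 1 := by nlinarith [sq_nonneg (z 2)]
    have := mul_le_mul_of_nonneg_right h4 hc.1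
    linarith [hc.2.2]
  have h3 : Real.exp (-(b * τ)) ≤ Real.exp (s * b * τ) := by
    apply Real.exp_le_exp.2
    nlinarith
  have h4 := Real.add_one_le_exp (-((2 * b + m ^ 2 + b ^ 2) * τ))
  have e : Real.exp (-((2 * b + m ^ 2 + b ^ 2) * τ)) = Real.exp (-τ * m ^ 2) *
      Real.exp (-(b * τ)) * Real.exp (-(b * τ)) * Real.exp (-(b ^ 2 * τ)) := by
    rw [← Real.exp_add, ← Real.exp_add, ← Real.exp_add]; ring_nf
  have h5 : Real.exp (-τ * m ^ 2) *
      Real.exp (-(b * τ)) * Real.exp (-(b * τ)) * Real.exp (-(b ^ 2 * τ)) ≤ hK m b s z τ := by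
    unfold hK; gcongr
  linarith

/-- bound for the logarithmic derivative -/
lemma lK_abs (m b s : ℝ) (hb : 0 < b) (hs : s ≤ 1) (z : EuclideanSpace ℝ (Fin 3)) {τ : ℝ}
    (ht : 0 < τ) : |lK m b s z τ| ≤
      (m ^ 2 + (1 - s) * b) + 3 / 2 / τ + ‖z‖ ^ 2 / 4 / τ ^ 2 := by
  have hx : 0 < b * τ := by positivity
  have hc := coth_b hb ht
  have hsh := Real.self_le_sinh_iff.2 hx.le
  have h1 : b ^ 2 / Real.sinh (b * τ) ^ 2 ≤ 1 / τ ^ 2 := by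
    have : (b * τ) ^ 2 ≤ Real.sinh (b * τ) ^ 2 := by gcongr
    rw [div_le_div_iff₀ (by positivity) (by positivity)]
    nlinarith
  have h2 : 0 ≤ b ^ 2 / Real.sinh (b * τ) ^ 2 := by positivity
  have h3 : ((z 0) ^ 2 + (z 1) ^ 2) / 4 * (b ^ 2 / Real.sinh (b * τ) ^ 2)
      ≤ ((z 0) ^ 2 + (z 1) ^ 2) / 4 * (1 / τ ^ 2) := by gcongr
  have h3' : 0 ≤ ((z 0) ^ 2 + (z 1) ^ 2) / 4 * (b ^ 2 / Real.sinh (b * τ) ^ 2) := by positivity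
  have h4 : ‖z‖ ^ 2 / 4 / τ ^ 2 = ((z 0) ^ 2 + (z 1) ^ 2) / 4 * (1 / τ ^ 2)
      + (z 2) ^ 2 / (4 * τ ^ 2) := by
    rw [norm_sq3]; field_simp
  have h5 : 0 ≤ (z 2) ^ 2 / (4 * τ ^ 2) := by positivity
  have h6 : 3 / 2 / τ = 1 / (2 * τ) + 1 / τ := by field_simp; norm_num
  have h7 : 0 < 1 / (2 * τ) := by positivity
  have h8 : 0 < 1 / τ := by positivity
  have h9 : 0 ≤ (1 - s) * b := mul_nonneg (by linarith) hb.le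
  have h10 : 1 / (2 * τ) = 1 / τ / 2 := by field_simp
  -- b - b coth ≤ 1 / τ
  have h11 : b ≤ b * coth (b * τ) := by
    unfold coth
    have hs' : 0 < Real.sinh (b * τ) := by linarith
    have : 1 ≤ Real.cosh (b * τ) / Real.sinh (b * τ) := by
      rw [le_div_iff₀ hs', one_mul]; exact (Real.sinh_lt_cosh _).le
    nlinarith
  unfold lK
  rw [h4, h6, abs_le]
  constructor <;> nlinarith [sq_nonneg m]

lemma uf_le (m b s : ℝ) (hb : 0 < b) (hs : s ≤ 1) (z : EuclideanSpace ℝ (Fin 3)) {τ : ℝ}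
    (ht : 0 < τ) : 0 ≤ τ ^ (-(1 : ℝ) / 2) * fK m b s z τ ∧ τ ^ (-(1 : ℝ) / 2) * fK m b s z τ ≤
      kap * (1 / τ ^ 2 * Real.exp (-(‖z‖ ^ 2 / 4 / τ)) * (1 + 2 * b * τ)) := by
  rw [rep m b s hb z ht]
  have h0 := hK_nonneg m b s hb z ht
  have h1 := hK_le' m b s hb hs z ht
  have hk := kap_pos
  constructor
  · positivity
  · gcongr

lemma uf'_le (m b s : ℝ) (hb : 0 < b) (hs : s ≤ 1) (z : EuclideanSpace ℝ (Fin 3)) {τ : ℝ}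
    (ht : 0 < τ) : |τ ^ (-(1 : ℝ) / 2) * (fK m b s z τ * lK m b s z τ)| ≤
      kap * (9 / 2) * (1 / τ ^ 3 * Real.exp (-(‖z‖ ^ 2 / 8 / τ)))
      + kap * 9 * b * (1 / τ ^ 2 * Real.exp (-(‖z‖ ^ 2 / 8 / τ))) := by
  rw [← mul_assoc, rep m b s hb z ht, abs_mul]
  have h0 := hK_nonneg m b s hb z ht
  have hk := kap_pos
  rw [abs_of_nonneg (by positivity)]
  have hl := lK_abs m b s hb hs z ht
  set M := m ^ 2 + (1 - s) * b with hM
  have hM0 : 0 ≤ M := add_nonneg (sq_nonneg m) (mul_nonneg (by linarith) hb.le)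
  set E := Real.exp (-(‖z‖ ^ 2 / 8 / τ)) with hE
  have hE0 : 0 < E := Real.exp_pos _
  have hE1 : E ≤ 1 := by
    rw [hE, Real.exp_le_one_iff, neg_nonpos]; positivity
  have hEE : Real.exp (-(‖z‖ ^ 2 / 4 / τ)) = E * E := by
    rw [hE, ← Real.exp_add]; congr 1; ring
  have hxE : ∀ x : ℝ, x * Real.exp (-x) ≤ 1 := by
    intro x
    have h1 := Real.add_one_le_exp x
    have h2 : Real.exp x * Real.exp (-x) = 1 := by rw [← Real.exp_add]; simp
    have h3 := Real.exp_pos (-x)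
    nlinarith
  have hA : ‖z‖ ^ 2 / 4 / τ * E ≤ 2 := by
    have := hxE (‖z‖ ^ 2 / 8 / τ)
    rw [← hE] at this
    have e : ‖z‖ ^ 2 / 4 / τ = 2 * (‖z‖ ^ 2 / 8 / τ) := by ring
    rw [e]; linarith
  set X := Real.exp (-(M * τ)) with hX
  have hX0 : 0 < X := Real.exp_pos _
  have hX1 : X ≤ 1 := by
    rw [hX, Real.exp_le_one_iff, neg_nonpos]; positivity
  have hMX : M * τ * X ≤ 1 := hxE (M * τ)
  have hh : hK m b s z τ ≤ X * (1 + 2 * b * τ) := hK_le m b s hb z ht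
  rw [hEE]
  have hbr : X * E * (M + 3 / 2 / τ + ‖z‖ ^ 2 / 4 / τ ^ 2) ≤ 9 / 2 / τ := by
    rw [le_div_iff₀ ht]
    have e : X * E * (M + 3 / 2 / τ + ‖z‖ ^ 2 / 4 / τ ^ 2) * τ =
        E * (M * τ * X) + 3 / 2 * (X * E) + X * (‖z‖ ^ 2 / 4 / τ * E) := by
      field_simp
    rw [e]
    have a1 : E * (M * τ * X) ≤ 1 * 1 := by gcongr
    have a2 : X * E ≤ 1 * 1 := by gcongr
    have a3 : X * (‖z‖ ^ 2 / 4 / τ * E) ≤ 1 * 2 := by gcongr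
    linarith
  calc kap * (1 / τ ^ 2 * (E * E) * hK m b s z τ) * |lK m b s z τ|
      ≤ kap * (1 / τ ^ 2 * (E * E) * (X * (1 + 2 * b * τ))) *
        (M + 3 / 2 / τ + ‖z‖ ^ 2 / 4 / τ ^ 2) := by gcongr
    _ = kap * (1 / τ ^ 2 * E * (1 + 2 * b * τ)) *
        (X * E * (M + 3 / 2 / τ + ‖z‖ ^ 2 / 4 / τ ^ 2)) := by ring
    _ ≤ kap * (1 / τ ^ 2 * E * (1 + 2 * b * τ)) * (9 / 2 / τ) := by gcongr
    _ = _ := by field_simp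

open Filter Topology in
lemma lim_exp_zero {a : ℝ} (ha : 0 < a) (k : ℕ) :
    Tendsto (fun t : ℝ => 1 / t ^ k * Real.exp (-(a / t))) (𝓝[>] 0) (𝓝 0) := by
  have h := (tendsto_rpow_mul_exp_neg_mul_atTop_nhds_zero (k : ℝ) a ha).comp
    tendsto_inv_nhdsGT_zero
  refine h.congr fun t => ?_
  simp [Real.rpow_natCast, div_eq_mul_inv]

open Filter Topology in
lemma ibp (m b s : ℝ) (hb : 0 < b) (hs : s ≤ 1) (z : EuclideanSpace ℝ (Fin 3))
    (hz : 0 < ‖z‖) :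
    IntegrableOn (fun τ : ℝ => 1 / τ ^ 3 * Real.exp (-(‖z‖ ^ 2 / 4 / τ)) * hK m b s z τ)
      (Set.Ioi 0) ∧
    ∫ τ in Set.Ioi (0 : ℝ), τ ^ (-(1 : ℝ) / 2) * deriv (fK m b s z) τ =
      kap / 2 * ∫ τ in Set.Ioi (0 : ℝ),
        1 / τ ^ 3 * Real.exp (-(‖z‖ ^ 2 / 4 / τ)) * hK m b s z τ := by
  have hk := kap_pos
  have ha : 0 < ‖z‖ ^ 2 / 4 := by positivity
  have ha' : 0 < ‖z‖ ^ 2 / 8 := by positivity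
  have hint : IntegrableOn
      (fun τ : ℝ => 1 / τ ^ 3 * Real.exp (-(‖z‖ ^ 2 / 4 / τ)) * hK m b s z τ) (Set.Ioi 0) := by
    have hg := (int_inv_cube ha).1.add ((int_inv_sq ha).1.const_mul (2 * b))
    refine Integrable.mono' hg ?_ ?_
    · apply Measurable.aestronglyMeasurable
      unfold hK coth
      fun_prop
    · refine (ae_restrict_iff' measurableSet_Ioi).2 (Eventually.of_forall fun τ ht => ?_)
      have ht : 0 < τ := ht
      have h0 := hK_nonneg m b s hb z ht
      have h1 := hK_le' m b s hb hs z ht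
      rw [Real.norm_of_nonneg (by positivity)]
      calc _ ≤ 1 / τ ^ 3 * Real.exp (-(‖z‖ ^ 2 / 4 / τ)) * (1 + 2 * b * τ) := by gcongr
        _ = _ := by simp only [Pi.add_apply]; field_simp
  refine ⟨hint, ?_⟩
  have hu : ∀ x ∈ Set.Ioi (0 : ℝ), HasDerivAt (fun t : ℝ => t ^ (-(1 : ℝ) / 2))
      ((fun t : ℝ => -(1 / 2) * (1 / t) * t ^ (-(1 : ℝ) / 2)) x) x := by
    intro x hx
    have hx : 0 < x := hx
    have := Real.hasDerivAt_rpow_const (x := x) (p := -(1 : ℝ) / 2) (Or.inl hx.ne')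
    convert this using 1
    rw [Real.rpow_sub_one hx.ne']
    ring
  have hv : ∀ x ∈ Set.Ioi (0 : ℝ), HasDerivAt (fK m b s z) (deriv (fK m b s z) x) x :=
    fun x hx => (hasDerivAt_fK m b s hb z hx).differentiableAt.hasDerivAt
  have huv' : IntegrableOn ((fun t : ℝ => t ^ (-(1 : ℝ) / 2)) * deriv (fK m b s z))
      (Set.Ioi 0) := by
    have hg := ((int_inv_cube ha').1.const_mul (kap * (9 / 2))).add
      ((int_inv_sq ha').1.const_mul (kap * 9 * b))
    refine Integrable.mono' hg ?_ ?_
    · apply Measurable.aestronglyMeasurable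
      exact (by fun_prop : Measurable fun t : ℝ => t ^ (-(1 : ℝ) / 2)).mul (measurable_deriv _)
    · refine (ae_restrict_iff' measurableSet_Ioi).2 (Eventually.of_forall fun τ ht => ?_)
      have := uf'_le m b s hb hs z ht
      rw [Pi.mul_apply, (hasDerivAt_fK m b s hb z ht).deriv, Real.norm_eq_abs]
      exact this
  have key : ∀ τ ∈ Set.Ioi (0 : ℝ), -(kap / 2) *
      (1 / τ ^ 3 * Real.exp (-(‖z‖ ^ 2 / 4 / τ)) * hK m b s z τ) =
      (-(1 / 2) * (1 / τ) * τ ^ (-(1 : ℝ) / 2)) * fK m b s z τ := by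
    intro τ ht
    have ht : 0 < τ := ht
    rw [mul_assoc (-(1 / 2) * (1 / τ)), rep m b s hb z ht]
    field_simp
  have hu'v : IntegrableOn ((fun t : ℝ => -(1 / 2) * (1 / t) * t ^ (-(1 : ℝ) / 2)) *
      fK m b s z) (Set.Ioi 0) :=
    IntegrableOn.congr_fun (hint.const_mul (-(kap / 2))) key measurableSet_Ioi
  have h_zero : Tendsto ((fun t : ℝ => t ^ (-(1 : ℝ) / 2)) * fK m b s z) (𝓝[>] 0) (𝓝 0) := by
    have hl := ((lim_exp_zero ha 2).const_mul kap).add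
      ((lim_exp_zero ha 1).const_mul (kap * (2 * b)))
    simp only [mul_zero, add_zero] at hl
    refine tendsto_of_tendsto_of_tendsto_of_le_of_le' tendsto_const_nhds hl ?_ ?_
    · filter_upwards [self_mem_nhdsWithin] with t ht
      exact (uf_le m b s hb hs z ht).1
    · filter_upwards [self_mem_nhdsWithin] with t ht
      have ht' : 0 < t := ht
      refine (uf_le m b s hb hs z ht).2.trans_eq ?_
      field_simp
  have h_inf : Tendsto ((fun t : ℝ => t ^ (-(1 : ℝ) / 2)) * fK m b s z) atTop (𝓝 0) := by
    have l1 : Tendsto (fun t : ℝ => t⁻¹) atTop (𝓝 0) := tendsto_inv_atTop_zero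
    have hl := ((l1.mul l1).const_mul kap).add (l1.const_mul (kap * (2 * b)))
    simp only [mul_zero, add_zero] at hl
    refine tendsto_of_tendsto_of_tendsto_of_le_of_le' tendsto_const_nhds hl ?_ ?_
    · filter_upwards [eventually_gt_atTop 0] with t ht
      exact (uf_le m b s hb hs z ht).1
    · filter_upwards [eventually_gt_atTop 0] with t ht
      refine (uf_le m b s hb hs z ht).2.trans ?_
      have hE1 : Real.exp (-(‖z‖ ^ 2 / 4 / t)) ≤ 1 := by
        rw [Real.exp_le_one_iff, neg_nonpos]; positivity
      calc _ ≤ kap * (1 / t ^ 2 * 1 * (1 + 2 * b * t)) := by gcongr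
        _ = _ := by field_simp
  have := integral_Ioi_mul_deriv_eq_deriv_mul hu hv huv' hu'v h_zero h_inf
  rw [this, ← setIntegral_congr_fun measurableSet_Ioi key, integral_const_mul]
  ring

lemma kap_eq : kap * Real.sqrt π * (8 * π) = 1 := by
  have hp := Real.pi_pos
  unfold kap
  rw [show (-(1 : ℝ) / 2) = -(1 / 2) by norm_num, Real.rpow_neg (by positivity),
    ← Real.sqrt_eq_rpow, Real.sqrt_mul (by norm_num),
    show Real.sqrt 4 = 2 by rw [show (4 : ℝ) = 2 ^ 2 by norm_num]; simp]
  have : 0 < Real.sqrt π := Real.sqrt_pos.2 hp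
  field_simp
  norm_num

/-- Let `m ≥ 0`, `b > 0` and `s ∈ {-1, +1}`. The leading singularity of `G` at the origin
is `-1/(π²|z|⁴)`: there exist `C > 0` and `δ > 0` such that for all `z` with
`0 < |z| < δ` one has `|G(z) + 1/(π²|z|⁴)| ≤ C/|z|²`. -/
theorem kinKernel_leading_singularity (m b : ℝ) (hm : 0 ≤ m) (hb : 0 < b)
    (s : ℝ) (hs : s = -1 ∨ s = 1) :
    ∃ C : ℝ, 0 < C ∧ ∃ δ : ℝ, 0 < δ ∧ ∀ z : EuclideanSpace ℝ (Fin 3),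
      0 < ‖z‖ → ‖z‖ < δ →
      |kinKernel m b s z + 1 / (π ^ 2 * ‖z‖ ^ 4)| ≤ C / ‖z‖ ^ 2 := by
  have hs1 : s ≤ 1 := by rcases hs with h | h <;> rw [h] <;> norm_num
  have hs2 : -1 ≤ s := by rcases hs with h | h <;> rw [h]; norm_num
  have hk := kap_pos
  have hsp : 0 < Real.sqrt π := Real.sqrt_pos.2 Real.pi_pos
  set K : ℝ := 2 * b + m ^ 2 + b ^ 2 with hK'
  have hK0 : 0 < K := by positivity
  refine ⟨1 / Real.sqrt π * (kap / 2) * (4 * K), by positivity, 1, one_pos, ?_⟩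
  intro z hz hz1
  obtain ⟨hint, hI⟩ := ibp m b s hb hs1 z hz
  have ha : 0 < ‖z‖ ^ 2 / 4 := by positivity
  obtain ⟨hg, hgv⟩ := int_inv_cube ha
  obtain ⟨hg2, hg2v⟩ := int_inv_sq ha
  have hdef : kinKernel m b s z = -(1 / Real.sqrt π) *
      ∫ τ in Set.Ioi (0 : ℝ), τ ^ (-(1 : ℝ) / 2) * deriv (fK m b s z) τ := rfl
  have hfree : 1 / (π ^ 2 * ‖z‖ ^ 4) = 1 / Real.sqrt π * (kap / 2) *
      ∫ t in Set.Ioi (0 : ℝ), 1 / t ^ 3 * Real.exp (-(‖z‖ ^ 2 / 4 / t)) := by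
    rw [hgv]
    have hsq : Real.sqrt π * Real.sqrt π = π := Real.mul_self_sqrt Real.pi_pos.le
    have hkk : kap = 1 / (Real.sqrt π * (8 * π)) := by
      rw [eq_div_iff (by positivity), ← kap_eq]; ring
    have hsq2 : 1 / Real.sqrt π * (kap / 2) = 1 / (16 * π ^ 2) := by
      rw [hkk]
      have : 1 / √π * (1 / (√π * (8 * π)) / 2) = 1 / ((√π * √π) * (16 * π)) := by
        field_simp; norm_num
      rw [this, hsq]; ring
    rw [hsq2]
    field_simp
    norm_num
  have hdiff : |(∫ t in Set.Ioi (0 : ℝ),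
        1 / t ^ 3 * Real.exp (-(‖z‖ ^ 2 / 4 / t)) * hK m b s z t)
      - ∫ t in Set.Ioi (0 : ℝ), 1 / t ^ 3 * Real.exp (-(‖z‖ ^ 2 / 4 / t))|
      ≤ K * (1 / (‖z‖ ^ 2 / 4)) := by
    rw [← integral_sub hint hg, ← hg2v, ← integral_const_mul, ← Real.norm_eq_abs]
    refine norm_integral_le_of_norm_le (hg2.const_mul K) ?_
    refine (ae_restrict_iff' measurableSet_Ioi).2 (Filter.Eventually.of_forall fun t ht => ?_)
    have ht : 0 < t := ht
    have h1 := hK_le' m b s hb hs1 z ht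
    have h2 := hK_ge m b s hb hs2 z hz1.le ht
    have h3 : |hK m b s z t - 1| ≤ K * t := by
      rw [abs_le]
      constructor
      · linarith
      · have : 0 ≤ (m ^ 2 + b ^ 2) * t := by positivity
        rw [hK']; linarith
    have e : 1 / t ^ 3 * Real.exp (-(‖z‖ ^ 2 / 4 / t)) * hK m b s z t
        - 1 / t ^ 3 * Real.exp (-(‖z‖ ^ 2 / 4 / t)) =
        (1 / t ^ 3 * Real.exp (-(‖z‖ ^ 2 / 4 / t))) * (hK m b s z t - 1) := by ring
    rw [e, norm_mul, Real.norm_eq_abs (hK m b s z t - 1), Real.norm_of_nonneg (by positivity)]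
    calc _ ≤ (1 / t ^ 3 * Real.exp (-(‖z‖ ^ 2 / 4 / t))) * (K * t) := by gcongr
      _ = _ := by field_simp
  rw [hdef, hI, hfree]
  set A := ∫ t in Set.Ioi (0 : ℝ), 1 / t ^ 3 * Real.exp (-(‖z‖ ^ 2 / 4 / t)) * hK m b s z t
  set B := ∫ t in Set.Ioi (0 : ℝ), 1 / t ^ 3 * Real.exp (-(‖z‖ ^ 2 / 4 / t))
  have e : -(1 / Real.sqrt π) * (kap / 2 * A) + 1 / Real.sqrt π * (kap / 2) * B =
      -((1 / Real.sqrt π * (kap / 2)) * (A - B)) := by ring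
  rw [e, abs_neg, abs_mul, abs_of_pos (by positivity : 0 < 1 / Real.sqrt π * (kap / 2))]
  calc _ ≤ 1 / Real.sqrt π * (kap / 2) * (K * (1 / (‖z‖ ^ 2 / 4))) := by gcongr
    _ = _ := by field_simp
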